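/- Let T be a nonempty finite index set, let η : Ω → ℝ^T be a binary process on a probability space (Ω, 𝓕, P), and fix t ∈ T with 0 < P(η_t = 1) < 1. Let h : ℝ → ℝ be twice continuously differentiable, fix x = (x_s)_{s∈T} ∈ ℝ^T, and define g : ℝ^T → ℝ by g(u) = Σ_{s∈T} h(x_s − u_s) (the log conditional density of additive-noise data x given signal u, up to the noise normalization). Write h'(x) = (h'(x_s))_{s∈T} and h''(x) = (h''(x_s))_{s∈T}. For i ∈ {0,1} let E_{i}[·] and Cov_{i}(·) denote expectation and covariance conditional on {η_t = i}, and for ε ∈ ℝ define r(ε) = ln( P(η_t = 1)/P(η_t = 0) ) + ln E_{1}[exp(g(ε·η))] − ln E_{0}[exp(g(ε·η))]. Then, as ε → 0, r(ε) = ln( P(η_t = 1)/P(η_t = 0) ) − h'(x)ᵀ( E_{1}[η] − E_{0}[η] ) ε + (1/2) h'(x)ᵀ( Cov_{1}(η) − Cov_{0}(η) ) h'(x) ε² + (1/2) h''(x)ᵀ( E_{1}[η] − E_{0}[η] ) ε² + o(ε²). -/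

import Mathlib

open MeasureTheory ProbabilityTheory Asymptotics Filter Topology

/-- Second-order Taylor expansion, with little-o remainder, of `ε ↦ f (x - ε)` at `0`. -/
theorem taylor_two_sub_isLittleO {f : ℝ → ℝ} (hf : ContDiff ℝ 2 f) (x : ℝ) :
    (fun ε => f (x - ε) - f x - (-deriv f x * ε + deriv (deriv f) x / 2 * ε ^ 2))
      =o[𝓝 (0 : ℝ)] (fun ε => ε ^ 2) := by
  have key := taylor_isLittleO_univ (x₀ := x) (n := 2) (f := f) hf
  have ht : Tendsto (fun ε : ℝ => x - ε) (𝓝 0) (𝓝 x) := by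
    have : Continuous fun ε : ℝ => x - ε := by fun_prop
    simpa using this.tendsto 0
  refine (key.comp_tendsto ht).congr (fun ε => ?_) (fun ε => ?_)
  · simp only [Function.comp, taylorWithinEval_succ, taylor_within_zero_eval,
      iteratedDerivWithin_univ, iteratedDeriv_succ, iteratedDeriv_zero, smul_eq_mul]
    norm_num
    ring
  · simp

theorem cube_isLittleO_sq {f : ℝ → ℝ} (hf : f =O[𝓝 0] (fun ε : ℝ => ε)) :
    (fun ε => f ε ^ 3) =o[𝓝 (0 : ℝ)] (fun ε => ε ^ 2) :=
  (hf.pow 3).trans_isLittleO (isLittleO_pow_pow (by norm_num))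

theorem isBigO_id_of_quadratic_expansion {f : ℝ → ℝ} {a b : ℝ}
    (hf : (fun ε => f ε - (a * ε + b * ε ^ 2)) =o[𝓝 (0 : ℝ)] (fun ε => ε ^ 2)) :
    f =O[𝓝 0] (fun ε : ℝ => ε) := by
  have h2 : (fun ε : ℝ => ε ^ 2) =O[𝓝 0] (fun ε : ℝ => ε) := by
    simpa using (isLittleO_pow_pow (𝕜 := ℝ) (m := 1) (n := 2) (by norm_num)).isBigO
  refine (((hf.isBigO.trans h2).add ((isBigO_refl _ _).const_mul_left a)).add
    (h2.const_mul_left b)).congr_left fun ε => ?_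
  ring

theorem mul_isLittleO_of_quadratic_expansion {f g : ℝ → ℝ} {a b a' b' : ℝ}
    (hf : (fun ε => f ε - (a * ε + b * ε ^ 2)) =o[𝓝 (0 : ℝ)] (fun ε => ε ^ 2))
    (hg : (fun ε => g ε - (a' * ε + b' * ε ^ 2)) =o[𝓝 (0 : ℝ)] (fun ε => ε ^ 2)) :
    (fun ε => f ε * g ε - a * a' * ε ^ 2) =o[𝓝 (0 : ℝ)] (fun ε => ε ^ 2) := by
  have linear : ∀ {f : ℝ → ℝ} {a b : ℝ},
      (fun ε => f ε - (a * ε + b * ε ^ 2)) =o[𝓝 (0 : ℝ)] (fun ε => ε ^ 2) →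
      (fun ε => f ε - a * ε) =O[𝓝 0] (fun ε : ℝ => ε ^ 2) := fun {f a b} hf =>
    (hf.isBigO.add ((isBigO_refl _ _).const_mul_left b)).congr_left fun ε => by ring
  have h32 : (fun ε : ℝ => ε ^ 3) =o[𝓝 0] (fun ε : ℝ => ε ^ 2) :=
    isLittleO_pow_pow (by norm_num)
  have e1 := (isBigO_id_of_quadratic_expansion hf).mul (linear hg)
  have e2 := ((isBigO_refl (fun ε : ℝ => ε) (𝓝 0)).const_mul_left a').mul (linear hf)
  refine ((e1.add e2).trans_isLittleO (h32.congr_left fun ε => ?_)).congr_left fun ε => ?_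
  · ring
  · ring

theorem log_one_add_quadratic_expansion {f : ℝ → ℝ} {a b : ℝ}
    (hf : (fun ε => f ε - (a * ε + b * ε ^ 2)) =o[𝓝 (0 : ℝ)] (fun ε => ε ^ 2)) :
    (fun ε => Real.log (1 + f ε) - (a * ε + (b - a ^ 2 / 2) * ε ^ 2))
      =o[𝓝 (0 : ℝ)] (fun ε => ε ^ 2) := by
  have hO := isBigO_id_of_quadratic_expansion hf
  have ht : Tendsto f (𝓝 0) (𝓝 0) := hO.trans_tendsto tendsto_id
  have hrem : (fun ε => Real.log (1 + f ε) - (f ε - f ε ^ 2 / 2)) =o[𝓝 (0 : ℝ)]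
      (fun ε => ε ^ 2) := by
    refine IsBigO.trans_isLittleO (IsBigO.of_bound 2 ?_) (cube_isLittleO_sq hO)
    filter_upwards [ht.eventually (Metric.ball_mem_nhds 0 (by norm_num : (0 : ℝ) < 1 / 2))]
      with ε hε
    have hε' : |f ε| < 1 / 2 := by simpa using hε
    have hb := Real.abs_log_sub_add_sum_range_le (x := -f ε) (by rw [abs_neg]; linarith) 2
    rw [abs_neg] at hb
    have hle : |f ε| ^ 3 / (1 - |f ε|) ≤ 2 * |f ε| ^ 3 := by
      rw [div_le_iff₀ (by linarith)]
      nlinarith [pow_nonneg (abs_nonneg (f ε)) 3]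
    rw [Real.norm_eq_abs, Real.norm_eq_abs, abs_pow]
    refine le_trans (le_of_eq ?_) (hb.trans hle)
    congr 1
    simp [Finset.sum_range_succ]
    ring
  have hsq := mul_isLittleO_of_quadratic_expansion hf hf
  refine ((hrem.add hf).add (hsq.const_mul_left (-1 / 2))).congr_left fun ε => ?_
  ring

theorem abs_exp_sub_quadratic_le {x : ℝ} (hx : |x| ≤ 1) :
    |Real.exp x - (1 + x + x ^ 2 / 2)| ≤ |x| ^ 3 := by
  have hb := Real.exp_bound hx (n := 3) (by norm_num)
  norm_num [Finset.sum_range_succ, Nat.factorial] at hb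
  nlinarith [pow_nonneg (abs_nonneg x) 3]

section BinaryMoments

variable {T : Type*} [Fintype T] {Ω : Type*} [MeasurableSpace Ω]
  {Q : Measure Ω} [IsProbabilityMeasure Q] {η : Ω → T → ℝ}

/-- Quadratic expansion of the moment generating function of a binary process along a curve
`d` in the space of exponents that vanishes at `0`. -/
theorem integral_exp_quadratic_expansion (hη : Measurable η)
    (hbin : ∀ t : T, ∀ᵐ ω ∂Q, η ω t = 0 ∨ η ω t = 1) {d : T → ℝ → ℝ} {a b : T → ℝ}
    (hd : ∀ s, (fun ε => d s ε - (a s * ε + b s * ε ^ 2)) =o[𝓝 (0 : ℝ)] (fun ε => ε ^ 2)) :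
    (fun ε => (∫ ω, Real.exp (∑ s, η ω s * d s ε) ∂Q) - 1
        - ((∑ s, a s * ∫ ω, η ω s ∂Q) * ε
          + ((∑ s, b s * ∫ ω, η ω s ∂Q)
            + (∑ s, ∑ u, a s * a u * ∫ ω, η ω s * η ω u ∂Q) / 2) * ε ^ 2))
      =o[𝓝 (0 : ℝ)] (fun ε => ε ^ 2) := by
  have hbin' : ∀ᵐ ω ∂Q, ∀ s, |η ω s| ≤ 1 := by
    rw [ae_all_iff]
    intro s
    filter_upwards [hbin s] with ω hω
    rcases hω with h | h <;> simp [h]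
  have hm : ∀ s, Measurable fun ω => η ω s := fun s => (measurable_pi_apply s).comp hη
  have hint1 : ∀ s, Integrable (fun ω => η ω s) Q := fun s =>
    Integrable.of_bound (hm s).aestronglyMeasurable 1 (hbin'.mono fun ω hω => hω s)
  have hint2 : ∀ s u, Integrable (fun ω => η ω s * η ω u) Q := fun s u =>
    Integrable.of_bound ((hm s).mul (hm u)).aestronglyMeasurable 1 <| hbin'.mono fun ω hω => by
      rw [norm_mul]
      exact mul_le_one₀ (hω s) (norm_nonneg _) (hω u)
  have hW : ∀ ε, ∀ᵐ ω ∂Q, |∑ s, η ω s * d s ε| ≤ ∑ s, |d s ε| := fun ε =>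
    hbin'.mono fun ω hω => (Finset.abs_sum_le_sum_abs _ _).trans <|
      Finset.sum_le_sum fun s _ => by
        rw [abs_mul]
        exact mul_le_of_le_one_left (abs_nonneg _) (hω s)
  have hWm : ∀ ε, Measurable fun ω => ∑ s, η ω s * d s ε := fun ε =>
    Finset.measurable_fun_sum _ fun s _ => (hm s).mul_const _
  have hexp : ∀ ε, Integrable (fun ω => Real.exp (∑ s, η ω s * d s ε)) Q := fun ε =>
    Integrable.of_bound (hWm ε).exp.aestronglyMeasurable (Real.exp (∑ s, |d s ε|)) <|
      (hW ε).mono fun ω hω => by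
        rw [Real.norm_eq_abs, Real.abs_exp, Real.exp_le_exp]
        exact (le_abs_self _).trans hω
  have hint1' : ∀ ε s, Integrable (fun ω => η ω s * d s ε) Q := fun ε s =>
    (hint1 s).mul_const _
  have hint2' : ∀ ε s u, Integrable (fun ω => η ω s * η ω u * (d s ε * d u ε)) Q :=
    fun ε s u => (hint2 s u).mul_const _
  have hsq : ∀ ε ω, (∑ s, η ω s * d s ε) ^ 2
      = ∑ s, ∑ u, η ω s * η ω u * (d s ε * d u ε) := fun ε ω => by
    rw [sq, Finset.sum_mul_sum]
    exact Finset.sum_congr rfl fun s _ => Finset.sum_congr rfl fun u _ => by ring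
  have hi1 : ∀ ε, Integrable (fun ω => ∑ s, η ω s * d s ε) Q := fun ε =>
    integrable_finsetSum _ fun s _ => hint1' ε s
  have hi2 : ∀ ε, Integrable (fun ω => (∑ s, η ω s * d s ε) ^ 2 / 2) Q := fun ε => by
    simp only [hsq]
    exact (integrable_finsetSum _ fun s _ =>
      integrable_finsetSum _ fun u _ => hint2' ε s u).div_const 2
  have hi01 : ∀ ε, Integrable (fun ω => 1 + ∑ s, η ω s * d s ε) Q := fun ε =>
    (integrable_const 1).add (hi1 ε)
  have hi012 : ∀ ε, Integrable
      (fun ω => 1 + ∑ s, η ω s * d s ε + (∑ s, η ω s * d s ε) ^ 2 / 2) Q := fun ε =>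
    (hi01 ε).add (hi2 ε)
  have hquad : ∀ ε, ∫ ω, (1 + ∑ s, η ω s * d s ε + (∑ s, η ω s * d s ε) ^ 2 / 2) ∂Q
      = 1 + (∑ s, (∫ ω, η ω s ∂Q) * d s ε)
        + (∑ s, ∑ u, (∫ ω, η ω s * η ω u ∂Q) * (d s ε * d u ε)) / 2 := fun ε => by
    rw [integral_add (hi01 ε) (hi2 ε),
      integral_add (integrable_const 1) (hi1 ε),
      integral_div, integral_finsetSum _ fun s _ => hint1' ε s]
    simp only [hsq]
    rw [integral_finsetSum _ fun s _ => integrable_finsetSum _ fun u _ => hint2' ε s u]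
    simp_rw [integral_finsetSum _ fun u _ => hint2' _ _ u, integral_mul_const]
    simp
  have hDO : (fun ε => ∑ s, |d s ε|) =O[𝓝 0] (fun ε : ℝ => ε) :=
    IsBigO.fun_sum fun s _ => (isBigO_id_of_quadratic_expansion (hd s)).abs_left
  have hDt : Tendsto (fun ε => ∑ s, |d s ε|) (𝓝 0) (𝓝 0) := hDO.trans_tendsto tendsto_id
  have hrem : (fun ε => (∫ ω, Real.exp (∑ s, η ω s * d s ε) ∂Q)
      - (1 + (∑ s, (∫ ω, η ω s ∂Q) * d s ε)
        + (∑ s, ∑ u, (∫ ω, η ω s * η ω u ∂Q) * (d s ε * d u ε)) / 2))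
      =o[𝓝 (0 : ℝ)] (fun ε => ε ^ 2) := by
    refine IsBigO.trans_isLittleO (IsBigO.of_bound 1 ?_) (cube_isLittleO_sq hDO)
    filter_upwards [hDt.eventually_le_const (by norm_num : (0 : ℝ) < 1)] with ε hε
    have h0 : 0 ≤ ∑ s, |d s ε| := Finset.sum_nonneg fun s _ => abs_nonneg _
    rw [← hquad, ← integral_sub (hexp ε) (hi012 ε),
      one_mul, Real.norm_of_nonneg (pow_nonneg h0 3)]
    refine (norm_integral_le_of_norm_le_const (C := (∑ s, |d s ε|) ^ 3)
      ((hW ε).mono fun ω hω => ?_)).trans_eq ?_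
    · exact (abs_exp_sub_quadratic_le (hω.trans hε)).trans
        (pow_le_pow_left₀ (abs_nonneg _) hω 3)
    · simp
  have hlin : (fun ε => ∑ s, (∫ ω, η ω s ∂Q) * (d s ε - (a s * ε + b s * ε ^ 2)))
      =o[𝓝 (0 : ℝ)] (fun ε => ε ^ 2) :=
    IsLittleO.fun_sum fun s _ => (hd s).const_mul_left _
  have hbil : (fun ε => ∑ s, ∑ u, (∫ ω, η ω s * η ω u ∂Q) *
      (d s ε * d u ε - a s * a u * ε ^ 2)) =o[𝓝 (0 : ℝ)] (fun ε => ε ^ 2) :=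
    IsLittleO.fun_sum fun s _ => IsLittleO.fun_sum fun u _ =>
      (mul_isLittleO_of_quadratic_expansion (hd s) (hd u)).const_mul_left _
  refine ((hrem.add hlin).add (hbil.const_mul_left (1 / 2))).congr_left fun ε => ?_
  have e1 : ∑ s, (∫ ω, η ω s ∂Q) * (d s ε - (a s * ε + b s * ε ^ 2))
      = (∑ s, (∫ ω, η ω s ∂Q) * d s ε) - (∑ s, a s * ∫ ω, η ω s ∂Q) * ε
        - (∑ s, b s * ∫ ω, η ω s ∂Q) * ε ^ 2 := by
    simp only [Finset.sum_mul, ← Finset.sum_sub_distrib]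
    exact Finset.sum_congr rfl fun s _ => by ring
  have e2 : ∑ s, ∑ u, (∫ ω, η ω s * η ω u ∂Q) * (d s ε * d u ε - a s * a u * ε ^ 2)
      = (∑ s, ∑ u, (∫ ω, η ω s * η ω u ∂Q) * (d s ε * d u ε))
        - (∑ s, ∑ u, a s * a u * ∫ ω, η ω s * η ω u ∂Q) * ε ^ 2 := by
    simp only [Finset.sum_mul, ← Finset.sum_sub_distrib]
    exact Finset.sum_congr rfl fun s _ => Finset.sum_congr rfl fun u _ => by ring
  rw [e1, e2]
  ring

/-- Quadratic expansion of the log-likelihood of additive-noise data under a binary signal. -/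
theorem log_integral_exp_additive_noise_expansion (hη : Measurable η)
    (hbin : ∀ t : T, ∀ᵐ ω ∂Q, η ω t = 0 ∨ η ω t = 1)
    {h : ℝ → ℝ} (hh : ContDiff ℝ 2 h) (x : T → ℝ) :
    (fun ε : ℝ => Real.log (∫ ω, Real.exp (∑ s, h (x s - (ε • η ω) s)) ∂Q)
        - ((∑ s, h (x s)) - (∑ s, deriv h (x s) * ∫ ω, η ω s ∂Q) * ε
          + (1 / 2) * (∑ s, ∑ u, deriv h (x s) * ((∫ ω, η ω s * η ω u ∂Q)
              - (∫ ω, η ω s ∂Q) * (∫ ω, η ω u ∂Q)) * deriv h (x u)) * ε ^ 2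
          + (1 / 2) * (∑ s, deriv (deriv h) (x s) * ∫ ω, η ω s ∂Q) * ε ^ 2))
      =o[𝓝 (0 : ℝ)] (fun ε => ε ^ 2) := by
  have hmom := integral_exp_quadratic_expansion hη hbin
    fun s => taylor_two_sub_isLittleO hh (x s)
  have hlog := log_one_add_quadratic_expansion hmom
  have hsplit : ∀ ε : ℝ, (∫ ω, Real.exp (∑ s, h (x s - (ε • η ω) s)) ∂Q)
      = Real.exp (∑ s, h (x s))
        * ∫ ω, Real.exp (∑ s, η ω s * (h (x s - ε) - h (x s))) ∂Q := fun ε => by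
    rw [← integral_const_mul]
    refine integral_congr_ae ?_
    filter_upwards [ae_all_iff.2 hbin] with ω hω
    rw [← Real.exp_add, ← Finset.sum_add_distrib]
    congr 1
    refine Finset.sum_congr rfl fun s _ => ?_
    rcases hω s with h | h <;> simp [h]
  have hpos : ∀ᶠ ε in 𝓝 (0 : ℝ),
      0 < ∫ ω, Real.exp (∑ s, η ω s * (h (x s - ε) - h (x s))) ∂Q := by
    have ht := (isBigO_id_of_quadratic_expansion hmom).trans_tendsto tendsto_id
    filter_upwards [ht.eventually_const_lt (by norm_num : (-1 : ℝ) < 0)] with ε hε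
    linarith
  refine hlog.congr' ?_ EventuallyEq.rfl
  filter_upwards [hpos] with ε hε
  rw [hsplit, Real.log_mul (Real.exp_ne_zero _) hε.ne', Real.log_exp, add_sub_cancel]
  have e1 : ∑ s, -deriv h (x s) * ∫ ω, η ω s ∂Q = -∑ s, deriv h (x s) * ∫ ω, η ω s ∂Q := by
    simp
  have e2 : ∑ s, deriv (deriv h) (x s) / 2 * ∫ ω, η ω s ∂Q
      = (∑ s, deriv (deriv h) (x s) * ∫ ω, η ω s ∂Q) / 2 := by
    rw [Finset.sum_div]
    exact Finset.sum_congr rfl fun s _ => by ring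
  have e3 : ∑ s, ∑ u, deriv h (x s) * ((∫ ω, η ω s * η ω u ∂Q)
        - (∫ ω, η ω s ∂Q) * (∫ ω, η ω u ∂Q)) * deriv h (x u)
      = (∑ s, ∑ u, -deriv h (x s) * -deriv h (x u) * ∫ ω, η ω s * η ω u ∂Q)
        - (∑ s, deriv h (x s) * ∫ ω, η ω s ∂Q) ^ 2 := by
    rw [sq, Finset.sum_mul_sum]
    simp only [← Finset.sum_sub_distrib]
    exact Finset.sum_congr rfl fun s _ => Finset.sum_congr rfl fun u _ => by ring
  rw [e1, e2, e3]
  ring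

end BinaryMoments


/-- Example 1 (additive noise, eq. (9)): with
`g u = ∑ s, h (x s − u s)`, the conditional log-likelihood ratio
`r(ε) = ln(P(η_t=1)/P(η_t=0)) + ln E₁[exp (g (ε • η))] − ln E₀[exp (g (ε • η))]`
has the expansion with linear coefficient `−h'(x)ᵀ(E₁[η] − E₀[η])` and the
quadratic terms involving `h'(x)` and `h''(x)`. -/
theorem cond_loglik_ratio_taylor_additive_noise
    {T : Type*} [Fintype T] [Nonempty T]
    {Ω : Type*} [MeasurableSpace Ω] (P : Measure Ω) [IsProbabilityMeasure P]
    (η : Ω → T → ℝ) (hη : Measurable η)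
    (hbin : ∀ t : T, ∀ᵐ ω ∂P, η ω t = 0 ∨ η ω t = 1)
    (t : T) (h0 : 0 < P {ω | η ω t = 1}) (h1 : P {ω | η ω t = 1} < 1)
    (h : ℝ → ℝ) (hh : ContDiff ℝ 2 h) (x : T → ℝ)
    (g : (T → ℝ) → ℝ) (hg : ∀ u : T → ℝ, g u = ∑ s, h (x s - u s)) :
    (fun ε : ℝ =>
        (Real.log ((P {ω | η ω t = 1}).toReal / (P {ω | η ω t = 0}).toReal)
          + Real.log (∫ ω, Real.exp (g (ε • η ω)) ∂(P[|{ω | η ω t = 1}]))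
          - Real.log (∫ ω, Real.exp (g (ε • η ω)) ∂(P[|{ω | η ω t = 0}])))
        - (Real.log ((P {ω | η ω t = 1}).toReal / (P {ω | η ω t = 0}).toReal)
          - (∑ s, deriv h (x s) * ((∫ ω, η ω s ∂(P[|{ω | η ω t = 1}]))
              - (∫ ω, η ω s ∂(P[|{ω | η ω t = 0}])))) * ε
          + (1 / 2) *
              (∑ s, ∑ u, deriv h (x s) *
                (((∫ ω, η ω s * η ω u ∂(P[|{ω | η ω t = 1}]))
                    - (∫ ω, η ω s ∂(P[|{ω | η ω t = 1}]))
                      * (∫ ω, η ω u ∂(P[|{ω | η ω t = 1}])))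
                  - ((∫ ω, η ω s * η ω u ∂(P[|{ω | η ω t = 0}]))
                    - (∫ ω, η ω s ∂(P[|{ω | η ω t = 0}]))
                      * (∫ ω, η ω u ∂(P[|{ω | η ω t = 0}])))) * deriv h (x u))
              * ε ^ 2
          + (1 / 2) *
              (∑ s, deriv (deriv h) (x s) *
                ((∫ ω, η ω s ∂(P[|{ω | η ω t = 1}]))
                  - (∫ ω, η ω s ∂(P[|{ω | η ω t = 0}])))) * ε ^ 2))
      =o[𝓝 (0 : ℝ)] (fun ε : ℝ => ε ^ 2) := by
  have hmt : Measurable fun ω => η ω t := (measurable_pi_apply t).comp hη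
  have hP0 : P {ω | η ω t = 0} ≠ 0 := fun hzero => by
    have hone : ∀ᵐ ω ∂P, ω ∈ {ω | η ω t = 1} := by
      have hne : ∀ᵐ ω ∂P, η ω t ≠ 0 := by simpa [ae_iff] using hzero
      filter_upwards [hbin t, hne] with ω hω hω0
      exact hω.resolve_left hω0
    exact h1.ne ((mem_ae_iff_prob_eq_one (hmt (measurableSet_singleton 1))).1 hone)
  have : IsProbabilityMeasure (P[|{ω | η ω t = 1}]) := cond_isProbabilityMeasure h0.ne'
  have : IsProbabilityMeasure (P[|{ω | η ω t = 0}]) := cond_isProbabilityMeasure hP0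
  have e1 := log_integral_exp_additive_noise_expansion (Q := P[|{ω | η ω t = 1}]) hη
    (fun s => cond_absolutelyContinuous.ae_le (hbin s)) hh x
  have e0 := log_integral_exp_additive_noise_expansion (Q := P[|{ω | η ω t = 0}]) hη
    (fun s => cond_absolutelyContinuous.ae_le (hbin s)) hh x
  refine (e1.sub e0).congr_left fun ε => ?_
  simp only [hg, mul_sub, sub_mul, Finset.sum_sub_distrib]
  ring
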